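/- Let f : ℝ² → ℝ² be an orientation-preserving homeomorphism of the plane. If f has a periodic point (a point p with fⁿ(p) = p for some n ≥ 1), then f has a fixed point. -/

import Mathlib

open Set Topology unitInterval

namespace BrouwerPlane

/-- The exponential covering of the punctured complex plane. -/
noncomputable def pexp (z : ℂ) : {z : ℂ // z ≠ 0} := ⟨Complex.exp z, Complex.exp_ne_zero z⟩

theorem pexp_cov : IsCoveringMap pexp := Complex.isCoveringMap_exp

/-- Uniqueness of continuous logarithms on preconnected sets. -/
theorem log_unique {E : Type*} [TopologicalSpace E] {D : Set E} (hD : IsPreconnected D)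
    {u v : E → ℂ} (hu : ContinuousOn u D) (hv : ContinuousOn v D)
    (h : ∀ x ∈ D, Complex.exp (u x) = Complex.exp (v x)) {x₀ : E} (hx₀ : x₀ ∈ D)
    (h₀ : u x₀ = v x₀) : ∀ x ∈ D, u x = v x := by
  have := pexp_cov.eqOn_of_comp_eqOn hD hu hv
    (fun x hx => Subtype.ext (h x hx)) hx₀ h₀
  exact this

/-- Homotopy lifting for the complex exponential. -/
theorem log_homotopy {A : Type*} [TopologicalSpace A] (G : I × A → ℂ) (hG : Continuous G)
    (hne : ∀ p, G p ≠ 0) (c : ℂ) (h0 : ∀ a, G (0, a) = Complex.exp c) :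
    ∃ L : I × A → ℂ, Continuous L ∧ (∀ p, Complex.exp (L p) = G p) ∧ ∀ a, L (0, a) = c := by
  let K : C(I × A, {z : ℂ // z ≠ 0}) := ⟨fun p => ⟨G p, hne p⟩, by fun_prop⟩
  have hK : ∀ a, K (0, a) = pexp ((ContinuousMap.const A c) a) := fun a =>
    Subtype.ext (h0 a)
  refine ⟨pexp_cov.liftHomotopy K (.const A c) hK, (pexp_cov.liftHomotopy K _ hK).continuous,
    fun p => ?_, fun a => ?_⟩
  · exact congrArg Subtype.val (congrFun (pexp_cov.liftHomotopy_lifts K _ hK) p)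
  · exact pexp_cov.liftHomotopy_zero K _ hK a

/-- Continuous logarithms on convex sets. -/
theorem log_convex {E : Type*} [NormedAddCommGroup E] [NormedSpace ℝ E] {D : Set E}
    (hD : Convex ℝ D) {g : E → ℂ} (hg : ContinuousOn g D) (hne : ∀ x ∈ D, g x ≠ 0)
    {x₀ : E} (hx₀ : x₀ ∈ D) {c : ℂ} (hc : Complex.exp c = g x₀) :
    ∃ L : E → ℂ, ContinuousOn L D ∧ (∀ x ∈ D, Complex.exp (L x) = g x) ∧ L x₀ = c := by
  classical
  have hmem : ∀ p : I × D, x₀ + (p.1 : ℝ) • ((p.2 : E) - x₀) ∈ D := fun p =>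
    hD.add_smul_sub_mem hx₀ p.2.2 p.1.2
  obtain ⟨L, hL, hexp, h0⟩ := log_homotopy
    (fun p : I × D => g (x₀ + (p.1 : ℝ) • ((p.2 : E) - x₀)))
    (hg.comp_continuous (by fun_prop) hmem)
    (fun p => hne _ (hmem p)) c (by intro a; simp [hc])
  have hconst : L (1, ⟨x₀, hx₀⟩) = c := by
    rw [← h0 ⟨x₀, hx₀⟩]
    refine log_unique (D := (univ : Set I)) isPreconnected_univ
      (u := fun τ => L (τ, ⟨x₀, hx₀⟩)) (v := fun _ => L (0, ⟨x₀, hx₀⟩)) (x₀ := 0)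
      ?_ ?_ ?_ (mem_univ _) rfl 1 (mem_univ _)
    · exact (hL.comp (by fun_prop)).continuousOn
    · fun_prop
    · intro τ _
      simp [hexp]
  refine ⟨fun x => if h : x ∈ D then L (1, ⟨x, h⟩) else 0, ?_, ?_, ?_⟩
  · rw [continuousOn_iff_continuous_domRestrict]
    have : D.domRestrict (fun x => if h : x ∈ D then L (1, ⟨x, h⟩) else 0) = fun x => L (1, x) := by
      ext x; exact dif_pos x.2
    rw [this]
    exact hL.comp (by fun_prop)
  · intro x hx
    simp [hx, hexp]
  · simp [hx₀, hconst]

/-- Identification of the plane with the complex numbers. -/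
noncomputable def cx (p : ℝ × ℝ) : ℂ := Complex.equivRealProdCLM.symm p

theorem cx_cont : Continuous cx := Complex.equivRealProdCLM.symm.continuous

theorem cx_sub (p q : ℝ × ℝ) : cx (p - q) = cx p - cx q := map_sub _ _ _

theorem cx_inj {p q : ℝ × ℝ} : cx p = cx q ↔ p = q :=
  Complex.equivRealProdCLM.symm.injective.eq_iff

/-- Pairs of distinct points. -/
abbrev A := {p : (ℝ × ℝ) × (ℝ × ℝ) // p.1 ≠ p.2}

/-- The rotation cocycle of an isotopy. -/
theorem rotation (f : (ℝ × ℝ) ≃ₜ (ℝ × ℝ))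
    (H : Set.Icc (0 : ℝ) 1 → (ℝ × ℝ) ≃ₜ (ℝ × ℝ))
    (hH : Continuous fun p : Set.Icc (0 : ℝ) 1 × (ℝ × ℝ) => H p.1 p.2)
    (h0 : H ⟨0, by norm_num⟩ = Homeomorph.refl (ℝ × ℝ))
    (h1 : H ⟨1, by norm_num⟩ = f) :
    ∃ R : (ℝ × ℝ) × (ℝ × ℝ) → ℂ, ContinuousOn R {p | p.1 ≠ p.2} ∧
      (∀ a b, a ≠ b → R (a, b) = R (b, a)) ∧
      ∀ a b, a ≠ b → Complex.exp (R (a, b)) * (cx b - cx a) = cx (f b) - cx (f a) := by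
  classical
  have hA : ∀ p : A, cx p.1.2 - cx p.1.1 ≠ 0 := fun p h =>
    p.2 (cx_inj.1 (sub_eq_zero.1 h)).symm
  have hc1 : Continuous fun p : I × A => cx (H p.1 p.2.1.1) :=
    cx_cont.comp (hH.comp (f := fun p : I × A => (p.1, p.2.1.1)) (by fun_prop))
  have hc2 : Continuous fun p : I × A => cx (H p.1 p.2.1.2) :=
    cx_cont.comp (hH.comp (f := fun p : I × A => (p.1, p.2.1.2)) (by fun_prop))
  have hc3 := cx_cont
  obtain ⟨L, hL, hexp, hL0⟩ := log_homotopy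
    (fun p : I × A => (cx (H p.1 p.2.1.2) - cx (H p.1 p.2.1.1)) / (cx p.2.1.2 - cx p.2.1.1))
    ((hc2.sub hc1).div (by fun_prop) (fun p => hA p.2))
    (fun p => div_ne_zero (fun h => p.2.2
      ((H p.1).injective (cx_inj.1 (sub_eq_zero.1 h))).symm) (hA p.2)) 0
    (by
      intro a
      have : H 0 = Homeomorph.refl _ := h0
      simp [this, div_self (hA a)])
  refine ⟨fun p => if h : p.1 ≠ p.2 then L (1, ⟨p, h⟩) else 0, ?_, ?_, ?_⟩
  · rw [continuousOn_iff_continuous_domRestrict]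
    have : Set.domRestrict {p : (ℝ × ℝ) × (ℝ × ℝ) | p.1 ≠ p.2}
        (fun p => if h : p.1 ≠ p.2 then L (1, ⟨p, h⟩) else 0) = fun x => L (1, x) := by
      ext x
      have hx : x.1.1 ≠ x.1.2 := x.2
      exact dif_pos hx
    rw [this]
    exact hL.comp (by fun_prop)
  · intro a b hab
    simp only [ne_eq, hab, hab.symm, not_false_eq_true, dite_true]
    refine log_unique (D := (univ : Set I)) isPreconnected_univ
      (u := fun τ => L (τ, ⟨(a, b), hab⟩)) (v := fun τ => L (τ, ⟨(b, a), hab.symm⟩)) (x₀ := 0)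
      ?_ ?_ ?_ (mem_univ _) ?_ 1 (mem_univ _)
    · exact (hL.comp (by fun_prop)).continuousOn
    · exact (hL.comp (by fun_prop)).continuousOn
    · intro τ _
      simp only [hexp]
      rw [← neg_div_neg_eq, neg_sub, neg_sub]
    · simp [hL0]
  · intro a b hab
    simp only [ne_eq, hab, not_false_eq_true, dite_true, hexp]
    have h1' : H 1 = f := h1
    rw [h1', div_mul_cancel₀ _ (hA ⟨(a, b), hab⟩)]

/-- The core winding argument: a curve with `α (a + 1) = f (α a)` has no simple closed piece. -/
theorem no_loop (f : (ℝ × ℝ) ≃ₜ (ℝ × ℝ)) (hf : ∀ q, f q ≠ q)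
    (R : (ℝ × ℝ) × (ℝ × ℝ) → ℂ) (hR : ContinuousOn R {p | p.1 ≠ p.2})
    (hsymm : ∀ a b, a ≠ b → R (a, b) = R (b, a))
    (hexp : ∀ a b, a ≠ b → Complex.exp (R (a, b)) * (cx b - cx a) = cx (f b) - cx (f a))
    (α : ℝ → ℝ × ℝ) (hα : Continuous α) (hshift : ∀ a, α (a + 1) = f (α a))
    (s t : ℝ) (hst : s + 1 < t) (hclosed : α s = α t)
    (hsimple : ∀ a b, s ≤ a → a < b → b ≤ t → α a = α b → a = s ∧ b = t)
    (hloc : ∀ a b, s ≤ a → a < b → b ≤ a + 1 → α a ≠ α b) : False := by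
  have hcx := cx_cont
  have hsub : ∀ {p q : ℝ × ℝ}, p ≠ q → cx q - cx p ≠ 0 := fun h hh =>
    h (cx_inj.1 (sub_eq_zero.1 hh)).symm
  -- the logarithm of the displacement
  obtain ⟨θ, hθ, hθexp, -⟩ := log_convex (D := (univ : Set (ℝ × ℝ))) convex_univ
    (g := fun y => cx (f y) - cx y) (by fun_prop) (fun y _ => hsub (hf y).symm)
    (x₀ := 0) (mem_univ _) (c := Complex.log (cx (f 0) - cx 0))
    (Complex.exp_log (hsub (hf 0).symm))
  have hθ : Continuous θ := by simpa using hθ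
  have hθexp : ∀ y, Complex.exp (θ y) = cx (f y) - cx y := fun y => hθexp y (mem_univ _)
  -- normalise the rotation
  obtain ⟨R, hR, hsymm, hexp, hθR⟩ : ∃ R : (ℝ × ℝ) × (ℝ × ℝ) → ℂ,
      ContinuousOn R {p | p.1 ≠ p.2} ∧ (∀ a b, a ≠ b → R (a, b) = R (b, a)) ∧
      (∀ a b, a ≠ b → Complex.exp (R (a, b)) * (cx b - cx a) = cx (f b) - cx (f a)) ∧
      ∀ y, θ (f y) = θ y + R (y, f y) := by
    let m := θ (f 0) - θ 0 - R (0, f 0)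
    have key : ∀ y, Complex.exp (θ (f y)) = Complex.exp (θ y + R (y, f y)) := by
      intro y
      rw [Complex.exp_add, hθexp, hθexp, ← hexp _ _ (hf y).symm]
      ring
    have hm : Complex.exp m = 1 := by
      have := key 0
      have e : θ (f 0) = m + (θ 0 + R (0, f 0)) := by simp only [m]; ring
      rw [e, Complex.exp_add] at this
      exact mul_right_cancel₀ (Complex.exp_ne_zero _) (this.trans (one_mul _).symm)
    refine ⟨fun p => R p + m, hR.add continuousOn_const, fun a b h => by simp [hsymm a b h],
      fun a b h => by simp [Complex.exp_add, hm, hexp a b h], fun y => ?_⟩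
    refine log_unique (D := (univ : Set (ℝ × ℝ))) isPreconnected_univ
      (u := fun y => θ (f y)) (v := fun y => θ y + (R (y, f y) + m)) (x₀ := 0)
      ?_ ?_ ?_ (mem_univ _) ?_ y (mem_univ _)
    · exact (hθ.comp f.continuous).continuousOn
    · refine hθ.continuousOn.add (ContinuousOn.add ?_ continuousOn_const)
      exact hR.comp (f := fun y => (y, f y)) (by fun_prop) (fun y _ => (hf y).symm)
    · intro y _
      rw [← add_assoc, Complex.exp_add _ m, hm, mul_one, key]
    · simp only [m]; ring
  -- the chord function
  let g : ℝ × ℝ → ℂ := fun p => cx (α p.2) - cx (α p.1)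
  have hg : Continuous g := by fun_prop
  let T : Set (ℝ × ℝ) := {p | s ≤ p.1 ∧ p.1 < p.2 ∧ p.2 ≤ t ∧ p.2 - p.1 < t - s}
  let S : Set (ℝ × ℝ) := {p | s ≤ p.1 ∧ p.1 < p.2 ∧ p.2 ≤ t + 1 ∧ p.2 ≤ p.1 + 1}
  let U : Set (ℝ × ℝ) := {p | s ≤ p.1 ∧ p.1 < p.2 ∧ p.2 ≤ t ∧ p.2 ≤ p.1 + 1}
  let W : Set (ℝ × ℝ) := {p | s ≤ p.1 ∧ p.1 < p.2 ∧ p.2 ≤ t - 1}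
  have hTc : Convex ℝ T := by
    rintro ⟨a, b⟩ ⟨h1, h2, h3, h4⟩ ⟨a', b'⟩ ⟨h1', h2', h3', h4'⟩ x y hx hy hxy
    simp only at h1 h2 h3 h4 h1' h2' h3' h4'
    obtain rfl : y = 1 - x := by linarith
    simp only [T, mem_ofPred_eq, Prod.smul_mk, Prod.mk_add_mk, smul_eq_mul]
    rcases eq_or_lt_of_le hx with rfl | hx
    · simp; exact ⟨h1', h2', h3', h4'⟩
    · refine ⟨?_, ?_, ?_, ?_⟩ <;> nlinarith
  have hSc : Convex ℝ S := by
    rintro ⟨a, b⟩ ⟨h1, h2, h3, h4⟩ ⟨a', b'⟩ ⟨h1', h2', h3', h4'⟩ x y hx hy hxy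
    simp only at h1 h2 h3 h4 h1' h2' h3' h4'
    obtain rfl : y = 1 - x := by linarith
    simp only [S, mem_ofPred_eq, Prod.smul_mk, Prod.mk_add_mk, smul_eq_mul]
    rcases eq_or_lt_of_le hx with rfl | hx
    · simp; exact ⟨h1', h2', h3', h4'⟩
    · refine ⟨?_, ?_, ?_, ?_⟩ <;> nlinarith
  have hUc : Convex ℝ U := by
    rintro ⟨a, b⟩ ⟨h1, h2, h3, h4⟩ ⟨a', b'⟩ ⟨h1', h2', h3', h4'⟩ x y hx hy hxy
    simp only at h1 h2 h3 h4 h1' h2' h3' h4'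
    obtain rfl : y = 1 - x := by linarith
    simp only [U, mem_ofPred_eq, Prod.smul_mk, Prod.mk_add_mk, smul_eq_mul]
    rcases eq_or_lt_of_le hx with rfl | hx
    · simp; exact ⟨h1', h2', h3', h4'⟩
    · refine ⟨?_, ?_, ?_, ?_⟩ <;> nlinarith
  have hWc : Convex ℝ W := by
    rintro ⟨a, b⟩ ⟨h1, h2, h3⟩ ⟨a', b'⟩ ⟨h1', h2', h3'⟩ x y hx hy hxy
    simp only at h1 h2 h3 h1' h2' h3'
    obtain rfl : y = 1 - x := by linarith
    simp only [W, mem_ofPred_eq, Prod.smul_mk, Prod.mk_add_mk, smul_eq_mul]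
    rcases eq_or_lt_of_le hx with rfl | hx
    · simp; exact ⟨h1', h2', h3'⟩
    · refine ⟨?_, ?_, ?_⟩ <;> nlinarith
  have hTne : ∀ p ∈ T, α p.1 ≠ α p.2 := by
    rintro ⟨a, b⟩ ⟨h1, h2, h3, h4⟩ h
    obtain ⟨rfl, rfl⟩ := hsimple a b h1 h2 h3 h
    exact lt_irrefl _ h4
  have hSne : ∀ p ∈ S, α p.1 ≠ α p.2 := by
    rintro ⟨a, b⟩ ⟨h1, h2, h3, h4⟩
    exact hloc a b h1 h2 h4
  have hUT : U ⊆ T := by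
    rintro ⟨a, b⟩ ⟨h1, h2, h3, h4⟩
    simp only at h1 h2 h3 h4
    exact ⟨h1, h2, h3, by simp only; linarith⟩
  have hUS : U ⊆ S := by
    rintro ⟨a, b⟩ ⟨h1, h2, h3, h4⟩
    simp only at h1 h2 h3 h4
    exact ⟨h1, h2, by simp only; linarith, h4⟩
  have hWT : W ⊆ T := by
    rintro ⟨a, b⟩ ⟨h1, h2, h3⟩
    simp only at h1 h2 h3
    refine ⟨h1, h2, ?_, ?_⟩ <;> simp only <;> linarith
  have hx0 : ((s, s + 1) : ℝ × ℝ) ∈ U := by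
    refine ⟨?_, ?_, ?_, ?_⟩ <;> simp only <;> linarith
  have hval : Complex.exp (θ (α s)) = g (s, s + 1) := by
    simp only [g, hshift, hθexp]
  obtain ⟨Φ, hΦ, hΦexp, hΦ0⟩ := log_convex hTc hg.continuousOn
    (fun p hp => hsub (hTne p hp)) (hUT hx0) hval
  obtain ⟨Ψ, hΨ, hΨexp, hΨ0⟩ := log_convex hSc hg.continuousOn
    (fun p hp => hsub (hSne p hp)) (hUS hx0) hval
  -- Φ and Ψ agree near the diagonal
  have eq1 : ∀ p ∈ U, Φ p = Ψ p := by
    refine log_unique hUc.isPreconnected (hΦ.mono hUT) (hΨ.mono hUS) ?_ hx0 (hΦ0.trans hΨ0.symm)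
    intro p hp
    rw [hΦexp p (hUT hp), hΨexp p (hUS hp)]
  have hdiag : ∀ a ∈ Icc s t, ((a, a + 1) : ℝ × ℝ) ∈ S := by
    rintro a ⟨h1, h2⟩
    refine ⟨?_, ?_, ?_, ?_⟩ <;> simp only <;> linarith
  have eq2 : ∀ a ∈ Icc s t, Ψ (a, a + 1) = θ (α a) := by
    refine log_unique (u := fun a => Ψ (a, a + 1)) (v := fun a => θ (α a)) (x₀ := s)
      isPreconnected_Icc ?_ (by fun_prop) ?_ ?_ hΨ0
    · exact hΨ.comp (f := fun a : ℝ => (a, a + 1)) (by fun_prop) hdiag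
    · intro a ha
      rw [hΨexp _ (hdiag a ha), hθexp]
      simp only [g, hshift]
    · exact ⟨le_rfl, by linarith⟩
  have hRT : ContinuousOn (fun p : ℝ × ℝ => R (α p.1, α p.2)) T :=
    hR.comp (f := fun p : ℝ × ℝ => (α p.1, α p.2)) (by fun_prop) hTne
  have hgshift : ∀ p ∈ T, Complex.exp (Φ p + R (α p.1, α p.2)) = g (p.1 + 1, p.2 + 1) := by
    intro p hp
    rw [Complex.exp_add, hΦexp p hp, mul_comm, hexp _ _ (hTne p hp)]
    simp only [g, hshift]
  have hUshift : ∀ p ∈ U, ((p.1 + 1, p.2 + 1) : ℝ × ℝ) ∈ S := by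
    rintro ⟨a, b⟩ ⟨h1, h2, h3, h4⟩
    simp only at h1 h2 h3 h4
    refine ⟨?_, ?_, ?_, ?_⟩ <;> simp only <;> linarith
  have eq3 : ∀ p ∈ U, Ψ (p.1 + 1, p.2 + 1) = Φ p + R (α p.1, α p.2) := by
    refine log_unique (u := fun p : ℝ × ℝ => Ψ (p.1 + 1, p.2 + 1)) hUc.isPreconnected ?_
      ((hΦ.add hRT).mono hUT) ?_ hx0 ?_
    · exact hΨ.comp (f := fun p : ℝ × ℝ => (p.1 + 1, p.2 + 1)) (by fun_prop) hUshift
    · intro p hp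
      rw [hΨexp _ (hUshift p hp)]
      exact (hgshift p (hUT hp)).symm
    · change Ψ (s + 1, s + 1 + 1) = Φ (s, s + 1) + R (α s, α (s + 1))
      rw [eq2 (s + 1) ⟨by linarith, by linarith⟩, hΦ0, hshift, hθR]
  have hWshift : ∀ p ∈ W, ((p.1 + 1, p.2 + 1) : ℝ × ℝ) ∈ T := by
    rintro ⟨a, b⟩ ⟨h1, h2, h3⟩
    simp only at h1 h2 h3
    refine ⟨?_, ?_, ?_, ?_⟩ <;> simp only <;> linarith
  have eq4 : ∀ p ∈ W, Φ (p.1 + 1, p.2 + 1) = Φ p + R (α p.1, α p.2) := by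
    let b := min (t - 1) (s + 1)
    have hb1 : b ≤ t - 1 := min_le_left _ _
    have hb2 : b ≤ s + 1 := min_le_right _ _
    have hb3 : s < b := lt_min (by linarith) (by linarith)
    refine log_unique (u := fun p : ℝ × ℝ => Φ (p.1 + 1, p.2 + 1)) (x₀ := (s, b))
      hWc.isPreconnected ?_ ((hΦ.add hRT).mono hWT) ?_ ⟨le_rfl, hb3, hb1⟩ ?_
    · exact hΦ.comp (f := fun p : ℝ × ℝ => (p.1 + 1, p.2 + 1)) (by fun_prop) hWshift
    · intro p hp
      rw [hΦexp _ (hWshift p hp)]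
      exact (hgshift p (hWT hp)).symm
    · have hU1 : ((s, b) : ℝ × ℝ) ∈ U := ⟨le_rfl, hb3, by simp only; linarith, hb2⟩
      have hU2 : ((s + 1, b + 1) : ℝ × ℝ) ∈ U := by
        refine ⟨?_, ?_, ?_, ?_⟩ <;> simp only <;> linarith
      exact (eq1 _ hU2).trans (eq3 _ hU1)
  -- the antipodal function
  have hc1 : ∀ c ∈ Ioo s t, ((s, c) : ℝ × ℝ) ∈ T := by
    rintro c ⟨h1, h2⟩
    refine ⟨?_, ?_, ?_, ?_⟩ <;> simp only <;> linarith
  have hc2 : ∀ c ∈ Ioo s t, ((c, t) : ℝ × ℝ) ∈ T := by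
    rintro c ⟨h1, h2⟩
    refine ⟨?_, ?_, ?_, ?_⟩ <;> simp only <;> linarith
  have hD : ∀ c ∈ Ioo s t, Complex.exp (Φ (c, t) - Φ (s, c)) = -1 := by
    intro c hc
    rw [Complex.exp_sub, hΦexp _ (hc1 c hc), hΦexp _ (hc2 c hc)]
    simp only [g, ← hclosed]
    rw [div_eq_iff (hsub (hTne _ (hc1 c hc)))]
    ring
  have m1 : s + 1 ∈ Ioo s t := ⟨by linarith, hst⟩
  have m2 : t - 1 ∈ Ioo s t := ⟨by linarith, by linarith⟩
  have eq5 : Φ (t - 1, t) - Φ (s, t - 1) = Φ (s + 1, t) - Φ (s, s + 1) := by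
    refine log_unique (D := Ioo s t) (u := fun c => Φ (c, t) - Φ (s, c))
      (v := fun _ => Φ (s + 1, t) - Φ (s, s + 1)) (x₀ := s + 1) isPreconnected_Ioo
      ?_ continuousOn_const ?_ m1 rfl (t - 1) m2
    · refine ContinuousOn.sub ?_ ?_
      · exact hΦ.comp (f := fun c : ℝ => (c, t)) (by fun_prop) hc2
      · exact hΦ.comp (f := fun c : ℝ => (s, c)) (by fun_prop) hc1
    · intro c hc
      rw [hD c hc, hD _ m1]
  -- conclusion
  have e1 : Φ (s + 1, t) = Φ (s, t - 1) + R (α s, α (t - 1)) := by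
    have := eq4 (s, t - 1) ⟨le_rfl, m2.1, le_rfl⟩
    simpa using this
  have ht1 : f (α (t - 1)) = α t := by rw [← hshift]; simp
  have e2 : θ (α t) = θ (α (t - 1)) + R (α (t - 1), α t) := by
    rw [← ht1, hθR]
  have e3 : θ (α (t - 1)) = Φ (t - 1, t) := by
    rw [← eq2 _ ⟨m2.1.le, m2.2.le⟩, sub_add_cancel]
    refine (eq1 _ ?_).symm
    refine ⟨?_, ?_, ?_, ?_⟩ <;> simp only <;> linarith
  have hne : α s ≠ α (t - 1) := hTne _ (hc1 _ m2)
  rw [← hclosed, ← hΦ0, e3, ← hsymm _ _ hne] at e2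
  have hzero : Φ (s + 1, t) - Φ (s, s + 1) = 0 := by
    linear_combination (1 / 2 : ℂ) * e1 - (1 / 2 : ℂ) * e2 - (1 / 2 : ℂ) * eq5
  have := hD _ m1
  rw [hzero, Complex.exp_zero] at this
  norm_num at this

/-- Existence of a translation arc through `x`. -/
theorem translation_arc (f : (ℝ × ℝ) ≃ₜ (ℝ × ℝ)) (hf : ∀ q, f q ≠ q) (x : ℝ × ℝ) :
    ∃ γ : ℝ → ℝ × ℝ, Continuous γ ∧ γ 1 = f (γ 0) ∧ γ (1 / 2) = x ∧
      (∀ a ∈ Icc (0 : ℝ) 1, ∀ b ∈ Icc (0 : ℝ) 1, γ a = γ b → a = b) ∧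
      (∀ a ∈ Icc (0 : ℝ) 1, ∀ b ∈ Icc (0 : ℝ) 1, γ a = f (γ b) →
        (a = 1 ∧ b = 0) ∨ (a = 0 ∧ b = 1)) := by
  have hfc := f.continuous
  obtain ⟨y, hy⟩ : ∃ y, ∀ z, max (dist y x) (dist (f y) x) ≤ max (dist z x) (dist (f z) x) := by
    have hc : Continuous fun z => max (dist z x) (dist (f z) x) := by fun_prop
    refine hc.exists_forall_le ?_
    refine Filter.tendsto_atTop_mono (fun z => le_max_left _ _) ?_
    exact tendsto_dist_right_cocompact_atTop x
  set r := max (dist y x) (dist (f y) x) with hr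
  have hr0 : 0 < r := by
    by_contra h
    have h1 : dist y x ≤ 0 := (le_max_left _ _).trans (not_lt.1 h)
    have h2 : dist (f y) x ≤ 0 := (le_max_right _ _).trans (not_lt.1 h)
    exact hf y ((dist_le_zero.1 h2).trans (dist_le_zero.1 h1).symm)
  have hfree : Disjoint (f '' Metric.ball x r) (Metric.ball x r) := by
    rw [Set.disjoint_left]
    rintro _ ⟨z, hz, rfl⟩ hzr
    exact absurd (hy z) (not_le.2 (max_lt hz hzr))
  -- the ball is disjoint from the closed ball under `f` and its inverse
  have hA : ∀ z, dist z x < r → r < dist (f z) x := by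
    have h := hfree.closure_right (f.isOpenMap _ Metric.isOpen_ball)
    rw [closure_ball x hr0.ne'] at h
    intro z hz
    by_contra hh
    exact Set.disjoint_left.1 h ⟨z, hz, rfl⟩ (not_lt.1 hh)
  have hB : ∀ z, dist z x ≤ r → r ≤ dist (f z) x := by
    have h := hfree.symm.closure_right Metric.isOpen_ball
    intro z hz
    by_contra hh
    refine Set.disjoint_left.1 h (not_le.1 hh : f z ∈ Metric.ball x r) ?_
    rw [← f.image_closure, closure_ball x hr0.ne']
    exact ⟨z, hz, rfl⟩
  have hy1 : dist y x = r := by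
    refine le_antisymm (le_max_left _ _) (not_lt.1 fun h => ?_)
    exact absurd (hA y h) (not_lt.2 (le_max_right _ _))
  have hy2 : dist (f y) x = r := le_antisymm (le_max_right _ _) (hB y hy1.le)
  let γ : ℝ → ℝ × ℝ := fun u => x + (max (1 - 2 * u) 0) • (y - x) + (max (2 * u - 1) 0) • (f y - x)
  have hlow : ∀ u, u ≤ 1 / 2 → γ u = x + (1 - 2 * u) • (y - x) := by
    intro u hu
    simp only [γ]
    rw [max_eq_left (by linarith), max_eq_right (by linarith)]
    simp
  have hhigh : ∀ u, 1 / 2 ≤ u → γ u = x + (2 * u - 1) • (f y - x) := by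
    intro u hu
    simp only [γ]
    rw [max_eq_right (by linarith), max_eq_left (by linarith)]
    simp
  have hdist : ∀ u, dist (γ u) x = |1 - 2 * u| * r := by
    intro u
    rcases le_total u (1 / 2) with h | h
    · rw [hlow u h, dist_eq_norm, add_sub_cancel_left, norm_smul, ← dist_eq_norm y x, hy1]
      rfl
    · rw [hhigh u h, dist_eq_norm, add_sub_cancel_left, norm_smul, ← dist_eq_norm (f y) x, hy2,
        abs_sub_comm]
      rfl
  have hγ0 : γ 0 = y := by rw [hlow 0 (by norm_num)]; simp
  have hγ1 : γ 1 = f y := by rw [hhigh 1 (by norm_num)]; norm_num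
  have hyne : ∀ u : ℝ, u ≠ 0 → u • (y - x) ≠ u • (f y - x) := by
    intro u hu h
    exact hf y (sub_left_injective (smul_right_injective _ hu h)).symm
  have hinj : ∀ a b : ℝ, a < b → γ a ≠ γ b := by
    intro a b hab h
    have hd : |1 - 2 * a| = |1 - 2 * b| := by
      have := hdist a
      rw [h, hdist b] at this
      exact (mul_right_cancel₀ hr0.ne' this).symm
    rcases abs_eq_abs.1 hd with h' | h'
    · linarith
    · rw [hlow a (by linarith), hhigh b (by linarith), add_right_inj] at h
      rw [show 2 * b - 1 = 1 - 2 * a by linarith] at h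
      exact hyne _ (by linarith) h
  have hinj' : ∀ a b : ℝ, γ a = γ b → a = b := by
    intro a b h
    rcases lt_trichotomy a b with h' | h' | h'
    · exact absurd h (hinj a b h')
    · exact h'
    · exact absurd h.symm (hinj b a h')
  have hle : ∀ a ∈ Icc (0 : ℝ) 1, dist (γ a) x ≤ r := by
    rintro a ⟨h0, h1⟩
    rw [hdist]
    have : |1 - 2 * a| ≤ 1 := abs_le.2 ⟨by linarith, by linarith⟩
    nlinarith
  have hlt : ∀ a ∈ Ioo (0 : ℝ) 1, dist (γ a) x < r := by
    rintro a ⟨h0, h1⟩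
    rw [hdist]
    have : |1 - 2 * a| < 1 := abs_lt.2 ⟨by linarith, by linarith⟩
    nlinarith
  refine ⟨γ, by fun_prop, by rw [hγ0, hγ1], by rw [hlow _ le_rfl]; norm_num,
    fun a _ b _ h => hinj' a b h, ?_⟩
  intro a ha b hb h
  have hb' : b = 0 ∨ b = 1 := by
    by_contra hh
    push Not at hh
    have := hA _ (hlt b ⟨lt_of_le_of_ne hb.1 hh.1.symm, lt_of_le_of_ne hb.2 hh.2⟩)
    rw [← h] at this
    exact absurd (hle a ha) (not_le.2 this)
  rcases hb' with rfl | rfl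
  · left
    rw [hγ0, ← hγ1] at h
    exact ⟨hinj' _ _ h, rfl⟩
  · right
    refine ⟨?_, rfl⟩
    have h1 := hB _ (hle 1 hb)
    rw [← h] at h1
    by_contra h0
    rcases eq_or_lt_of_le ha.2 with h2 | h2
    · subst h2
      exact hf _ h.symm
    · exact absurd (hlt a ⟨lt_of_le_of_ne ha.1 (Ne.symm h0), h2⟩) (not_lt.2 h1)

/-- Extension of a translation arc to an equivariant curve. -/
theorem extend_arc (f : (ℝ × ℝ) ≃ₜ (ℝ × ℝ)) (γ : ℝ → ℝ × ℝ) (hγ : Continuous γ)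
    (h1 : γ 1 = f (γ 0)) :
    ∃ α : ℝ → ℝ × ℝ, Continuous α ∧ (∀ a, α (a + 1) = f (α a)) ∧
      ∀ a ∈ Icc (0 : ℝ) 1, α a = γ a := by
  let α : ℝ → ℝ × ℝ := fun a => (f ^ ⌊a⌋ : (ℝ × ℝ) ≃ₜ (ℝ × ℝ)) (γ (Int.fract a))
  have hshift : ∀ a, α (a + 1) = f (α a) := by
    intro a
    simp only [α, Int.floor_add_one, Int.fract_add_one]
    rw [add_comm, zpow_add, zpow_one]
    rfl
  have hpiece : ∀ k : ℤ, ∀ a ∈ Icc (k : ℝ) (k + 1),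
      α a = (f ^ k : (ℝ × ℝ) ≃ₜ (ℝ × ℝ)) (γ (a - k)) := by
    rintro k a ⟨ha, hb⟩
    rcases eq_or_lt_of_le hb with h | h
    · subst h
      have : α (k : ℝ) = (f ^ k : (ℝ × ℝ) ≃ₜ (ℝ × ℝ)) (γ 0) := by simp [α]
      rw [hshift, this, add_sub_cancel_left, h1]
      change (f * f ^ k) (γ 0) = (f ^ k * f) (γ 0)
      rw [(Commute.refl f).zpow_right k |>.eq]
    · have : ⌊a⌋ = k := Int.floor_eq_iff.2 ⟨ha, h⟩
      simp only [α, Int.fract, this]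
  refine ⟨α, ?_, hshift, ?_⟩
  · have hlf : LocallyFinite fun k : ℤ => Icc (k : ℝ) (k + 1) := by
      intro a
      refine ⟨Ioo (a - 1) (a + 1), Ioo_mem_nhds (by linarith) (by linarith), ?_⟩
      refine (Set.finite_Icc (⌊a⌋ - 3) (⌊a⌋ + 3)).subset ?_
      rintro k ⟨z, ⟨hz1, hz2⟩, hz3, hz4⟩
      have e1 := Int.floor_le a
      have e2 := Int.lt_floor_add_one a
      constructor
      · have : ((⌊a⌋ - 3 : ℤ) : ℝ) ≤ k := by push_cast; linarith
        exact_mod_cast this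
      · have : (k : ℝ) ≤ ((⌊a⌋ + 3 : ℤ) : ℝ) := by push_cast; linarith
        exact_mod_cast this
    refine hlf.continuous ?_ (fun k => isClosed_Icc) ?_
    · refine Set.eq_univ_of_forall fun a => Set.mem_iUnion.2 ⟨⌊a⌋, Int.floor_le a, ?_⟩
      exact (Int.lt_floor_add_one a).le
    · intro k
      refine ContinuousOn.congr ?_ (hpiece k)
      exact ((f ^ k).continuous.comp (hγ.comp (by fun_prop))).continuousOn
  · intro a ha
    have := hpiece 0 a (by simpa using ha)
    simpa using this

end BrouwerPlane

open BrouwerPlane in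
/-- Brouwer plane translation theorem corollary: an orientation-preserving
homeomorphism of the plane (formalized as one isotopic to the identity
through homeomorphisms) with a periodic point has a fixed point. -/
theorem periodic_implies_fixed_plane (f : (ℝ × ℝ) ≃ₜ (ℝ × ℝ))
    (H : Set.Icc (0 : ℝ) 1 → (ℝ × ℝ) ≃ₜ (ℝ × ℝ))
    (hH : Continuous fun p : Set.Icc (0 : ℝ) 1 × (ℝ × ℝ) => H p.1 p.2)
    (h0 : H ⟨0, by norm_num⟩ = Homeomorph.refl (ℝ × ℝ))
    (h1 : H ⟨1, by norm_num⟩ = f)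
    (p : ℝ × ℝ) (n : ℕ) (hn : 1 ≤ n) (hp : (⇑f)^[n] p = p) :
    ∃ q : ℝ × ℝ, f q = q := by
  by_contra hcon
  have hf : ∀ q, f q ≠ q := fun q h => hcon ⟨q, h⟩
  obtain ⟨R, hR, hsymm, hexp⟩ := rotation f H hH h0 h1
  obtain ⟨γ, hγ, hγ1, hγp, hinj, htrans⟩ := translation_arc f hf p
  obtain ⟨α, hα, hshift, hαγ⟩ := extend_arc f γ hγ hγ1
  -- iterated shift
  have hiter : ∀ (k : ℕ) (a : ℝ), α (a + k) = (⇑f)^[k] (α a) := by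
    intro k
    induction k with
    | zero => intro a; simp
    | succ k ih =>
      intro a
      rw [Function.iterate_succ_apply', ← ih, ← hshift]
      push_cast
      ring_nf
  -- injectivity on `[0, 2]` except for the end points
  have htwo : ∀ a b : ℝ, 0 ≤ a → a < b → b ≤ 2 → α a = α b → a = 0 ∧ b = 2 := by
    intro a b ha hab hb h
    rcases le_total b 1 with hb1 | hb1
    · rw [hαγ a ⟨ha, by linarith⟩, hαγ b ⟨by linarith, hb1⟩] at h
      exact absurd (hinj a ⟨ha, by linarith⟩ b ⟨by linarith, hb1⟩ h) hab.ne
    · have hb' : α b = f (α (b - 1)) := by rw [← hshift]; simp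
      have mb : b - 1 ∈ Icc (0 : ℝ) 1 := ⟨by linarith, by linarith⟩
      rcases le_total a 1 with ha1 | ha1
      · rw [hb', hαγ a ⟨ha, ha1⟩, hαγ _ mb] at h
        rcases htrans a ⟨ha, ha1⟩ _ mb h with ⟨h2, h3⟩ | ⟨h2, h3⟩
        · linarith
        · exact ⟨h2, by linarith⟩
      · have ha' : α a = f (α (a - 1)) := by rw [← hshift]; simp
        have ma : a - 1 ∈ Icc (0 : ℝ) 1 := ⟨by linarith, by linarith⟩
        rw [ha', hb', f.injective.eq_iff, hαγ _ ma, hαγ _ mb] at h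
        have := hinj _ ma _ mb h
        linarith
  have hloc : ∀ a b : ℝ, 0 ≤ a → a < b → b ≤ a + 1 → α a ≠ α b := by
    intro a b ha hab hb h
    have e1 := Nat.floor_le ha
    have e2 := Nat.lt_floor_add_one a
    have ea := hiter ⌊a⌋₊ (a - ⌊a⌋₊)
    have eb := hiter ⌊a⌋₊ (b - ⌊a⌋₊)
    rw [sub_add_cancel] at ea eb
    rw [ea, eb, (f.injective.iterate _).eq_iff] at h
    have := htwo _ _ (by linarith) (by linarith) (by linarith) h
    linarith [this.1, this.2]
  -- the set of self-intersections
  let E : Set (ℝ × ℝ) := {q | 0 ≤ q.1 ∧ q.1 + 1 ≤ q.2 ∧ q.2 ≤ n + 1 ∧ α q.1 = α q.2}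
  have hEne : E.Nonempty := by
    have hn' : (1 : ℝ) ≤ n := by exact_mod_cast hn
    refine ⟨(1 / 2, 1 / 2 + n), ?_, ?_, ?_, ?_⟩
    · norm_num
    · simp only; linarith
    · simp only; linarith
    · simp only
      rw [hiter, hαγ _ ⟨by norm_num, by norm_num⟩, hγp, hp]
  have hEc : IsCompact E := by
    have hcl : IsClosed E := by
      have c1 : IsClosed {q : ℝ × ℝ | 0 ≤ q.1} := isClosed_le (by fun_prop) (by fun_prop)
      have c2 : IsClosed {q : ℝ × ℝ | q.1 + 1 ≤ q.2} := isClosed_le (by fun_prop) (by fun_prop)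
      have c3 : IsClosed {q : ℝ × ℝ | q.2 ≤ n + 1} := isClosed_le (by fun_prop) (by fun_prop)
      have c4 : IsClosed {q : ℝ × ℝ | α q.1 = α q.2} := isClosed_eq (by fun_prop) (by fun_prop)
      exact c1.inter (c2.inter (c3.inter c4))
    refine (isCompact_Icc (a := ((0, 0) : ℝ × ℝ)) (b := (n + 1, n + 1))).of_isClosed_subset hcl ?_
    rintro ⟨a, b⟩ ⟨e1, e2, e3, -⟩
    simp only at e1 e2 e3
    refine ⟨⟨?_, ?_⟩, ⟨?_, ?_⟩⟩ <;> simp only <;> linarith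
  obtain ⟨⟨s, t⟩, ⟨hs, hst, htn, hclosed⟩, hmin⟩ :=
    hEc.exists_isMinOn hEne (f := Prod.snd) continuous_snd.continuousOn
  simp only at hs hst htn hclosed
  have hlt : s + 1 < t := by
    refine lt_of_le_of_ne hst fun h => ?_
    rw [← h, hshift] at hclosed
    exact hf _ hclosed.symm
  have hmin' : ∀ a b : ℝ, 0 ≤ a → a < b → b ≤ n + 1 → α a = α b → t ≤ b := by
    intro a b ha hab hb h
    have h2 : a + 1 ≤ b := by
      by_contra h3
      exact hloc a b ha hab (not_le.1 h3).le h
    exact hmin (a := (a, b)) ⟨ha, h2, hb, h⟩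
  refine no_loop f hf R hR hsymm hexp α hα hshift s t hlt hclosed ?_
    (fun a b ha => hloc a b (hs.trans ha))
  intro a b ha hab hb h
  have hbt : b = t := le_antisymm hb (hmin' a b (hs.trans ha) hab (hb.trans htn) h)
  subst hbt
  refine ⟨?_, rfl⟩
  by_contra hne
  have hsa : s < a := lt_of_le_of_ne ha (Ne.symm hne)
  have := hmin' s a hs hsa (by linarith) (hclosed.trans h.symm)
  linarith
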